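/- arXiv:0906.3902 — 2 statements merged into one kernel-verified Lean document; each statement's English description precedes it below -/
import Mathlib

section
/- Let n and m be positive integers, let d = gcd(n, m), and suppose p and q are nonnegative integers with d = p·n − q·m. Then, setting N = p + q, there exist nondecreasing sequences of nonnegative integers 0 = q_0 ≤ q_1 ≤ … ≤ q_N = q and 0 = p_0 ≤ p_1 ≤ … ≤ p_N = p such that p_i + q_i + 1 = p_{i+1} + q_{i+1} for every index 0 ≤ i < N, and such that the inequalities 0 ≤ p_i·n − q_i·m ≤ m + n hold (in the integers) for every 0 ≤ i ≤ N. -/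
/-- Any lattice point `(p, q)` with `0 ≤ p·n − q·m ≤ m + n` is reached from `(0, 0)` by unit steps
that stay in this strip. Walking backwards, decrease `p` when the value is at least `n`, and `q`
otherwise. -/
theorem exists_unit_step_path_in_strip (n m : ℕ) (hn : 0 < n) (N : ℕ) :
    ∀ p q : ℕ, p + q = N → 0 ≤ (p : ℤ) * n - (q : ℤ) * m →
      (p : ℤ) * n - (q : ℤ) * m ≤ (m : ℤ) + n →
    ∃ P Q : ℕ → ℕ,
      P 0 = 0 ∧ Q 0 = 0 ∧ P N = p ∧ Q N = q ∧
      (∀ i < N, P i ≤ P (i + 1)) ∧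
      (∀ i < N, Q i ≤ Q (i + 1)) ∧
      (∀ i < N, P i + Q i + 1 = P (i + 1) + Q (i + 1)) ∧
      (∀ i ≤ N, 0 ≤ (P i : ℤ) * n - (Q i : ℤ) * m ∧
        (P i : ℤ) * n - (Q i : ℤ) * m ≤ (m : ℤ) + n) := by
  induction N with
  | zero =>
    intro p q h h0 h1
    obtain ⟨rfl, rfl⟩ : p = 0 ∧ q = 0 := by omega
    refine ⟨fun _ => 0, fun _ => 0, rfl, rfl, rfl, rfl, ?_, ?_, ?_, fun _ _ => ⟨h0, h1⟩⟩ <;>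
      intro i hi <;> omega
  | succ N ih =>
    intro p q h h0 h1
    obtain ⟨p', q', hp, hq, hN, h0', h1'⟩ : ∃ p' q' : ℕ, p' ≤ p ∧ q' ≤ q ∧ p' + q' = N ∧
        0 ≤ (p' : ℤ) * n - (q' : ℤ) * m ∧ (p' : ℤ) * n - (q' : ℤ) * m ≤ (m : ℤ) + n := by
      rcases le_or_gt (n : ℤ) ((p : ℤ) * n - (q : ℤ) * m) with hv | hv
      · rcases p with _ | p
        · have : (0 : ℤ) ≤ (q : ℤ) * m := by positivity
          push_cast at hv
          omega
        · refine ⟨p, q, by omega, le_rfl, by omega, ?_, ?_⟩ <;> push_cast at * <;> linarith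
      · rcases q with _ | q
        · obtain rfl : p = N + 1 := by omega
          have : (0 : ℤ) ≤ (N : ℤ) * n := by positivity
          push_cast at hv
          linarith
        · refine ⟨p, q, le_rfl, by omega, by omega, ?_, ?_⟩ <;> push_cast at * <;> linarith
    obtain ⟨P, Q, hP0, hQ0, hPN, hQN, hP, hQ, hPQ, hb⟩ := ih p' q' hN h0' h1'
    refine ⟨fun i => if i ≤ N then P i else p, fun i => if i ≤ N then Q i else q,
      by simpa, by simpa, by simp, by simp, ?_, ?_, ?_, ?_⟩
    · grind
    · grind
    · grind
    · intro i _
      by_cases hi : i ≤ N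
      · simpa only [if_pos hi] using hb i hi
      · simpa only [if_neg hi] using ⟨h0, h1⟩

/-- Lemma 4.9 (lem:number-theory): given positive integers `n, m` with
`d = gcd n m` expressed as `d = p·n − q·m` with `p, q : ℕ`, one can interpolate
from `(0,0)` to `(p,q)` by unit steps keeping `pᵢ·n − qᵢ·m` in `[0, m+n]`. -/
theorem euclidean_interpolation (n m : ℕ) (hn : 0 < n) (hm : 0 < m)
    (d : ℕ) (hd : d = Nat.gcd n m) (p q : ℕ)
    (hpq : (d : ℤ) = (p : ℤ) * n - (q : ℤ) * m) :
    ∃ P Q : ℕ → ℕ,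
      P 0 = 0 ∧ Q 0 = 0 ∧ P (p + q) = p ∧ Q (p + q) = q ∧
      (∀ i < p + q, P i ≤ P (i + 1)) ∧
      (∀ i < p + q, Q i ≤ Q (i + 1)) ∧
      (∀ i < p + q, P i + Q i + 1 = P (i + 1) + Q (i + 1)) ∧
      (∀ i ≤ p + q, 0 ≤ (P i : ℤ) * n - (Q i : ℤ) * m ∧
        (P i : ℤ) * n - (Q i : ℤ) * m ≤ (m : ℤ) + n) := by
  have hdm : d ≤ m := hd ▸ Nat.gcd_le_right n hm
  exact exists_unit_step_path_in_strip n m hn (p + q) p q rfl (by omega) (by omega)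
end

section
/- Let (G_i)_{i ∈ ι} be a family of groups and let G = ∗_i G_i be their free product (Mathlib: Monoid.CoprodI). Suppose γ, δ ∈ G are both hyperbolic, i.e. neither γ nor δ is conjugate in G to any element of the image of a factor G_i under the canonical inclusion, and suppose γ and δ commute: γ·δ = δ·γ. Then γ and δ lie in a common cyclic subgroup: there exist ρ ∈ G and integers a, b with γ = ρ^a and δ = ρ^b. -/
open Monoid

/-- An element of a free product is *hyperbolic* if it is not conjugate to any
element of the image of a factor under the canonical inclusion. -/
def IsHyperbolicElt {ι : Type*} {G : ι → Type*} [∀ i, Group (G i)]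
    (g : CoprodI G) : Prop :=
  ∀ i : ι, ∀ x : G i, ∀ h : CoprodI G, h * CoprodI.of x * h⁻¹ ≠ g

/-- Commuting lists have products which are powers of a common element. -/
theorem List.exists_pow_of_append_comm {α M : Type*} [Monoid M] (f : α → M) (a b : List α)
    (h : a ++ b = b ++ a) :
    ∃ (z : M) (m n : ℕ), (a.map f).prod = z ^ m ∧ (b.map f).prod = z ^ n := by
  induction hk : a.length + b.length using Nat.strong_induction_on generalizing a b with
  | _ k ih =>
    wlog hle : a.length ≤ b.length generalizing a b
    · obtain ⟨z, m, n, hb, ha⟩ := this b a h.symm (by omega) (by omega)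
      exact ⟨z, n, m, ha, hb⟩
    rcases eq_or_ne a [] with rfl | hne
    · exact ⟨(b.map f).prod, 0, 1, by simp, by simp⟩
    obtain ⟨c, rfl⟩ : a <+: b :=
      List.prefix_of_prefix_length_le (List.prefix_append a b) (h ▸ List.prefix_append b a) hle
    have hpos := List.length_pos_iff.mpr hne
    rw [List.append_assoc, List.append_cancel_left_eq] at h
    obtain ⟨z, m, n, ha, hc⟩ := ih _ (by rw [← hk]; simp only [List.length_append]; omega) a c h rfl
    exact ⟨z, m, m + n, ha, by rw [List.map_append, List.prod_append, ha, hc, pow_add]⟩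

namespace Monoid.CoprodI

section Monoid

variable {ι : Type*} {M : ι → Type*} [∀ i, Monoid (M i)]

/-- A list of letters is either reduced, or has the same product as a shorter list. -/
theorem reduced_or_exists_shorter (L : List (Σ i, M i)) :
    ((∀ l ∈ L, Sigma.snd l ≠ 1) ∧ L.IsChain fun l l' => Sigma.fst l ≠ Sigma.fst l') ∨
      ∃ L' : List (Σ i, M i), L'.length < L.length ∧
        (L'.map fun l => of l.snd).prod = (L.map fun l => of l.snd).prod := by
  induction L with
  | nil => simp
  | cons l L ih =>
    rcases ih with ⟨hone, hchain⟩ | ⟨L', hlt, hprod⟩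
    · by_cases hl : l.snd = 1
      · exact .inr ⟨L, by simp, by simp [hl]⟩
      cases L with
      | nil => exact .inl ⟨by simpa using hl, by simp⟩
      | cons l' L =>
        by_cases hidx : l.fst = l'.fst
        · obtain ⟨i, x⟩ := l
          obtain ⟨j, y⟩ := l'
          obtain rfl : i = j := hidx
          exact .inr ⟨⟨i, x * y⟩ :: L, by simp, by simp [mul_assoc]⟩
        · refine .inl ⟨?_, List.isChain_cons_cons.mpr ⟨hidx, hchain⟩⟩
          rw [List.forall_mem_cons]
          exact ⟨hl, hone⟩
    · exact .inr ⟨l :: L', by simpa using hlt, by simp [hprod]⟩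

theorem Word.exists_prod_eq_length_le (L : List (Σ i, M i)) :
    ∃ w : Word M, w.toList.length ≤ L.length ∧ w.prod = (L.map fun l => of l.snd).prod := by
  induction hn : L.length using Nat.strong_induction_on generalizing L with
  | _ n ih =>
    rcases reduced_or_exists_shorter L with ⟨hone, hchain⟩ | ⟨L', hlt, hprod⟩
    · exact ⟨⟨L, hone, hchain⟩, hn.le, rfl⟩
    · obtain ⟨w, hw, hwprod⟩ := ih _ (hn ▸ hlt) L' rfl
      exact ⟨w, by omega, hwprod.trans hprod⟩

theorem Word.prod_injective : Function.Injective (Word.prod : Word M → CoprodI M) := by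
  classical exact Word.equiv.symm.injective

/-- A reduced word is the unique shortest list of letters with its product. -/
theorem Word.eq_toList_of_length_le (w : Word M) (L : List (Σ i, M i))
    (hlen : L.length ≤ w.toList.length) (hprod : (L.map fun l => of l.snd).prod = w.prod) :
    L = w.toList := by
  rcases reduced_or_exists_shorter L with ⟨hone, hchain⟩ | ⟨L', hlt, hprod'⟩
  · exact congrArg Word.toList (Word.prod_injective (a₁ := ⟨L, hone, hchain⟩) hprod)
  · obtain ⟨w', hw', hwprod'⟩ := Word.exists_prod_eq_length_le L'
    obtain rfl : w' = w := Word.prod_injective (hwprod'.trans (hprod'.trans hprod))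
    omega

theorem NeWord.exists_pow_of_commute {i j k l : ι} (w : NeWord M i j) (u : NeWord M k l)
    (hjk : j ≠ k) (hcomm : Commute w.prod u.prod) :
    ∃ (z : CoprodI M) (m n : ℕ), w.prod = z ^ m ∧ u.prod = z ^ n := by
  refine List.exists_pow_of_append_comm (fun l => of l.snd) w.toList u.toList ?_
  refine ((NeWord.append w hjk u).toWord.eq_toList_of_length_le (u.toList ++ w.toList) ?_ ?_).symm
  · simp [NeWord.toWord, NeWord.toList, add_comm]
  · rw [List.map_append, List.prod_append]
    exact hcomm.eq.symm.trans NeWord.append_prod.symm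

end Monoid

variable {ι : Type*} {G : ι → Type*} [∀ i, Group (G i)]

/-- Elements commuting with a cyclically reduced word lie in a common cyclic subgroup with it. -/
theorem NeWord.exists_zpow_of_commute {i j : ι} (w : NeWord G i j) (hij : i ≠ j) (g : CoprodI G)
    (hcomm : Commute w.prod g) :
    ∃ (z : CoprodI G) (m n : ℤ), w.prod = z ^ m ∧ g = z ^ n := by
  obtain ⟨v, rfl⟩ : ∃ v : Word G, v.prod = g := by
    classical exact Word.equiv.symm.surjective g
  rcases eq_or_ne v Word.empty with rfl | hv
  · exact ⟨w.prod, 1, 0, by simp, by simp⟩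
  obtain ⟨k, l, u, rfl⟩ := NeWord.of_word v hv
  by_cases hjk : j = k
  · subst hjk
    obtain ⟨z, m, n, hw, hu⟩ := w.inv.exists_pow_of_commute u hij (by
      rw [NeWord.inv_prod]; exact hcomm.inv_left)
    refine ⟨z, -m, n, ?_, hu.trans (zpow_natCast z n).symm⟩
    rw [NeWord.inv_prod] at hw
    rw [zpow_neg, zpow_natCast, ← hw, inv_inv]
  · obtain ⟨z, m, n, hw, hu⟩ := w.exists_pow_of_commute u hjk hcomm
    exact ⟨z, m, n, hw.trans (zpow_natCast z m).symm, hu.trans (zpow_natCast z n).symm⟩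

/-- Every element of a free product is trivial, or conjugate into a factor, or conjugate to a
cyclically reduced word. -/
theorem eq_one_or_isConj_of_or_isConj_neWord (g : CoprodI G) :
    g = 1 ∨ (∃ (i : ι) (x : G i), IsConj (of x) g) ∨
      ∃ (i j : ι) (w : NeWord G i j), i ≠ j ∧ IsConj w.prod g := by
  obtain ⟨L, rfl⟩ : ∃ L : List (Σ i, G i), (L.map fun l => of l.snd).prod = g := by
    classical exact ⟨(Word.equiv g).toList, Word.equiv.symm_apply_apply g⟩
  induction hn : L.length using Nat.strong_induction_on generalizing L with
  | _ n ih =>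
    obtain ⟨v, hlen, hprod⟩ := Word.exists_prod_eq_length_le L
    rw [← hprod]
    rcases eq_or_ne v Word.empty with rfl | hv
    · exact .inl Word.prod_empty
    obtain ⟨i, j, w, rfl⟩ := NeWord.of_word v hv
    by_cases hij : i = j
    swap
    · exact .inr (.inr ⟨i, j, w, hij, IsConj.refl _⟩)
    subst hij
    obtain ⟨T, hT⟩ := List.head?_eq_some_iff.mp w.toList_head?
    have hlast := w.toList_getLast?
    change w.toList.length ≤ _ at hlen
    change _ ∨ (∃ (i : ι) (x : G i), IsConj (of x) (w.toList.map fun l => of l.snd).prod) ∨ _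
    rcases T.eq_nil_or_concat' with rfl | ⟨T, l, rfl⟩
    · exact .inr (.inl ⟨i, w.head, by
        simp only [hT, List.map_cons, List.map_nil, List.prod_singleton, IsConj.refl]⟩)
    · rw [hT] at hlast hlen
      obtain rfl : l = ⟨i, w.last⟩ := by
        rwa [← List.cons_append, List.getLast?_concat, Option.some_inj] at hlast
      let L' : List (Σ i, G i) := T ++ [⟨i, w.last * w.head⟩]
      have hconj : IsConj (L'.map fun l => of l.snd).prod w.toWord.prod := by
        refine isConj_iff.mpr ⟨of w.head, ?_⟩
        change _ = (w.toList.map fun l => of l.snd).prod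
        simp [L', hT, mul_assoc]
      rcases ih _ (by simp [L'] at hlen ⊢; omega) L' rfl with
        h | ⟨k, x, h⟩ | ⟨k, l, u, hkl, h⟩
      · rw [h, isConj_one_right] at hconj
        exact .inl hconj
      · exact .inr (.inl ⟨k, x, h.trans hconj⟩)
      · exact .inr (.inr ⟨k, l, u, hkl, h.trans hconj⟩)

end Monoid.CoprodI

/-- Commuting hyperbolic elements of a free product lie in a common cyclic
subgroup (Lemma 4.1, lem:axis-intersection). -/
theorem commuting_hyperbolic_common_cyclic
    {ι : Type*} {G : ι → Type*} [∀ i, Group (G i)]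
    (γ δ : CoprodI G) (hγ : IsHyperbolicElt γ) (hδ : IsHyperbolicElt δ)
    (hcomm : γ * δ = δ * γ) :
    ∃ (ρ : CoprodI G) (a b : ℤ), γ = ρ ^ a ∧ δ = ρ ^ b := by
  rcases CoprodI.eq_one_or_isConj_of_or_isConj_neWord γ with
    rfl | ⟨i, x, hconj⟩ | ⟨i, j, w, hij, hconj⟩
  · exact ⟨δ, 0, 1, by simp, by simp⟩
  · obtain ⟨h, hh⟩ := isConj_iff.mp hconj
    exact absurd hh (hγ i x h)
  · obtain ⟨h, rfl⟩ := isConj_iff.mp hconj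
    have hw : Commute w.prod (h⁻¹ * δ * h) := by
      have := congrArg (fun g => h⁻¹ * g * h) hcomm
      simpa [Commute, SemiconjBy, mul_assoc] using this
    obtain ⟨z, m, n, hm, hn⟩ := w.exists_zpow_of_commute hij _ hw
    refine ⟨h * z * h⁻¹, m, n, by rw [conj_zpow, hm], ?_⟩
    rw [conj_zpow, ← hn]
    group
end
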